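/- arXiv:2006.04510 — 4 statements merged into one kernel-verified Lean document; each statement's English description precedes it below -/
import Mathlib

section
/- Let x be a real number with x ≥ 1 and suppose g : E → ℝ satisfies the eigenvector equation B_ω g = x g, i.e. for every directed edge (i,j) ∈ E, Σ_{(k,l) ∈ E, j = k, i ≠ l} ω_{kl} g(k,l) = x · g(i,j). Define m : V → ℝ by m_i = Σ_{k : A_{ik} = 1} ω_{ik} · g(i,k). Then H_{ω/x} m = 0, i.e. for every i ∈ V, (1 + Σ_{k : A_{ik}=1} ω_{ik}²/(x² − ω_{ik}²)) · m_i − Σ_{j} A_{ij} · x·ω_{ij}/(x² − ω_{ij}²) · m_j = 0. -/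
/-- If `g` satisfies the eigenvector equation `B_ω g = x g` on the
directed edges of the graph, then `m_i = Σ_k ω_{ik} g_{ik}` satisfies `H_{ω/x} m = 0`. -/
theorem bethe_hessian_kernel_of_nonbacktracking_eigenvector
    {V : Type*} [Fintype V] [DecidableEq V]
    (A : V → V → ℝ) (ω : V → V → ℝ)
    (hAsymm : ∀ i j, A i j = A j i) (hAdiag : ∀ i, A i i = 0)
    (hA01 : ∀ i j, A i j = 0 ∨ A i j = 1)
    (hωsymm : ∀ i j, ω i j = ω j i)
    (hωsupp : ∀ i j, A i j = 0 → ω i j = 0)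
    (hωlt : ∀ i j, |ω i j| < 1)
    (x : ℝ) (hx : 1 ≤ x)
    (g : V → V → ℝ)
    (heig : ∀ i j, A i j = 1 →
      (∑ k, ∑ l, if A k l = 1 ∧ j = k ∧ i ≠ l then ω k l * g k l else 0) = x * g i j)
    (m : V → ℝ)
    (hm : ∀ i, m i = ∑ k, if A i k = 1 then ω i k * g i k else 0) :
    ∀ i, (1 + ∑ k, if A i k = 1 then ω i k ^ 2 / (x ^ 2 - ω i k ^ 2) else 0) * m i
      - (∑ j, A i j * (x * ω i j / (x ^ 2 - ω i j ^ 2)) * m j) = 0 := by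
  have message_passing : ∀ i j, A i j = 1 → m j - ω j i * g j i = x * g i j := by
    intro i j hij
    have hji : A j i = 1 := (hAsymm j i).trans hij
    rw [← heig i j hij, Finset.sum_eq_single j, hm j, sub_eq_iff_eq_add,
      ← Finset.add_sum_erase _ _ (Finset.mem_univ i),
      ← Finset.add_sum_erase (a := i) _ (fun l => if A j l = 1 ∧ j = j ∧ i ≠ l then _ else _)
        (Finset.mem_univ i)]
    · rw [if_pos hji, if_neg (by simp), zero_add, add_comm]
      congr 1
      refine Finset.sum_congr rfl fun l hl => ?_
      simp [(Finset.ne_of_mem_erase hl).symm]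
    · intro k _ hk
      simp [hk.symm]
    · simp
  intro i
  have hterm : ∀ k, (if A i k = 1 then ω i k * g i k else 0) =
      A i k * (x * ω i k / (x ^ 2 - ω i k ^ 2)) * m k
        - (if A i k = 1 then ω i k ^ 2 / (x ^ 2 - ω i k ^ 2) else 0) * m i := by
    intro k
    rcases hA01 i k with h | h
    · simp [h]
    · have hne : x ^ 2 - ω i k ^ 2 ≠ 0 := by
        have := (sq_lt_one_iff_abs_lt_one _).2 (hωlt i k)
        nlinarith
      have hik := message_passing i k h
      have hki := message_passing k i ((hAsymm k i).trans h)
      rw [hωsymm k i] at hik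
      rw [if_pos h, if_pos h, h]
      field_simp
      linear_combination (-x * ω i k) * hik + ω i k ^ 2 * hki
  have hsum := hm i
  rw [Finset.sum_congr rfl fun k _ => hterm k, Finset.sum_sub_distrib, ← Finset.sum_mul] at hsum
  linear_combination hsum
end

section
/- Let x be a real number with x ≥ 1 and suppose m : V → ℝ is a nonzero vector with H_{ω/x} m = 0. Define g : E → ℝ on directed edges by g(i,j) = (x·m_j − ω_{ij}·m_i)/(x² − ω_{ij}²). Then g is nonzero and satisfies B_ω g = x g, i.e. for every (i,j) ∈ E, Σ_{(k,l) ∈ E, j = k, i ≠ l} ω_{kl} g(k,l) = x · g(i,j). -/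
/-- If `m ≠ 0` lies in the kernel of the Bethe-Hessian `H_{ω/x}`, then
`g(i,j) = (x m_j − ω_{ij} m_i)/(x² − ω_{ij}²)` is a nonzero eigenvector of the weighted
non-backtracking matrix `B_ω` with eigenvalue `x`. -/
theorem nonbacktracking_eigenvector_of_bethe_hessian_kernel
    {V : Type*} [Fintype V] [DecidableEq V]
    (A : V → V → ℝ) (ω : V → V → ℝ)
    (hAsymm : ∀ i j, A i j = A j i) (hAdiag : ∀ i, A i i = 0)
    (hA01 : ∀ i j, A i j = 0 ∨ A i j = 1)
    (hωsymm : ∀ i j, ω i j = ω j i)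
    (hωsupp : ∀ i j, A i j = 0 → ω i j = 0)
    (hωlt : ∀ i j, |ω i j| < 1)
    (x : ℝ) (hx : 1 ≤ x)
    (m : V → ℝ) (hm0 : m ≠ 0)
    (hker : ∀ i, (1 + ∑ k, if A i k = 1 then ω i k ^ 2 / (x ^ 2 - ω i k ^ 2) else 0) * m i
      - (∑ j, A i j * (x * ω i j / (x ^ 2 - ω i j ^ 2)) * m j) = 0)
    (g : V → V → ℝ)
    (hg : ∀ i j, g i j = (x * m j - ω i j * m i) / (x ^ 2 - ω i j ^ 2)) :
    (∃ i j, A i j = 1 ∧ g i j ≠ 0) ∧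
    ∀ i j, A i j = 1 →
      (∑ k, ∑ l, if A k l = 1 ∧ j = k ∧ i ≠ l then ω k l * g k l else 0) = x * g i j := by
  have key : ∀ j, ∑ l, ω j l * g j l = m j := by
    intro j
    have h : ∑ l, ω j l * g j l = (∑ l, A j l * (x * ω j l / (x ^ 2 - ω j l ^ 2)) * m l)
        - (∑ l, if A j l = 1 then ω j l ^ 2 / (x ^ 2 - ω j l ^ 2) else 0) * m j := by
      rw [Finset.sum_mul, ← Finset.sum_sub_distrib]
      refine Finset.sum_congr rfl fun l _ => ?_
      rcases hA01 j l with h0 | h1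
      · simp [h0, hωsupp j l h0]
      · rw [if_pos h1, h1, hg]
        ring
    linarith [hker j]
  refine ⟨?_, fun i j hij => ?_⟩
  · by_contra! hzero
    refine hm0 (funext fun j => ?_)
    rw [← key j]
    refine Finset.sum_eq_zero fun l _ => ?_
    rcases hA01 j l with h0 | h1
    · rw [hωsupp j l h0, zero_mul]
    · rw [hzero j l h1, mul_zero]
  · have hsum : (∑ k, ∑ l, if A k l = 1 ∧ j = k ∧ i ≠ l then ω k l * g k l else 0)
        = m j - ω j i * g j i := by
      rw [Finset.sum_eq_single j (fun k _ hk => by simp [hk.symm]) (by simp), ← key j,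
        ← Finset.sum_erase_eq_sub (Finset.mem_univ i),
        ← Finset.sum_subset (Finset.subset_univ (Finset.univ.erase i))
          (fun l _ hl => by simp_all)]
      refine Finset.sum_congr rfl fun l hl => ?_
      have hil : i ≠ l := (Finset.ne_of_mem_erase hl).symm
      rcases hA01 j l with h0 | h1
      · simp [h0, hωsupp j l h0]
      · simp [h1, hil]
    have hD : x ^ 2 - ω i j ^ 2 ≠ 0 := by
      have := (sq_lt_one_iff_abs_lt_one _).2 (hωlt i j)
      nlinarith
    rw [hsum, hg, hg, hωsymm j i]
    field_simp
    ring
end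

section
/- For every real number x with x ≥ 1, x is an eigenvalue of the weighted non-backtracking matrix B_ω (i.e. there exists a nonzero g : E → ℝ with B_ω g = x g) if and only if the determinant of the Bethe-Hessian matrix H_{ω/x} is zero. -/
/-- The action of the weighted non-backtracking matrix on an edge function, written as a full
vertex sum minus the backtracking term. -/
theorem sum_nonbacktracking_eq {V : Type*} [Fintype V] [DecidableEq V]
    (A ω : V → V → ℝ) (hω : ∀ i j, A i j ≠ 1 → ω i j = 0) (G : V → V → ℝ) (i j : V) :
    (∑ e : {p : V × V // A p.1 p.2 = 1},
      if j = e.1.1 ∧ i ≠ e.1.2 then ω e.1.1 e.1.2 * G e.1.1 e.1.2 else 0)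
      = ∑ l, ω j l * G j l - ω j i * G j i := by
  have hsub := Finset.sum_subtype (Finset.univ.filter fun p : V × V => A p.1 p.2 = 1)
    (p := fun p : V × V => A p.1 p.2 = 1) (F := by infer_instance) (by simp)
    (fun p : V × V => if j = p.1 ∧ i ≠ p.2 then ω p.1 p.2 * G p.1 p.2 else 0)
  rw [← hsub, Finset.sum_filter, Fintype.sum_prod_type, Finset.sum_eq_single j]
  · have hback : ∑ l, (if i = l then ω j l * G j l else 0) = ω j i * G j i := by simp
    rw [eq_sub_iff_add_eq, ← hback, ← Finset.sum_add_distrib]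
    refine Finset.sum_congr rfl fun l _ => ?_
    by_cases hA : A j l = 1 <;> by_cases hil : i = l <;> simp [hA, hil, hω j l]
  · intro k _ hk
    simp [hk.symm]
  · simp


/-- For `x ≥ 1`, `x` is an eigenvalue of the weighted non-backtracking
matrix `B_ω` (there is a nonzero `g : E → ℝ` with `B_ω g = x g`) iff `det H_{ω/x} = 0`. -/
theorem nonbacktracking_eigenvalue_iff_bethe_hessian_det_eq_zero
    {V : Type*} [Fintype V] [DecidableEq V]
    (A : V → V → ℝ) (ω : V → V → ℝ)
    (hAsymm : ∀ i j, A i j = A j i) (hAdiag : ∀ i, A i i = 0)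
    (hA01 : ∀ i j, A i j = 0 ∨ A i j = 1)
    (hωsymm : ∀ i j, ω i j = ω j i)
    (hωsupp : ∀ i j, A i j = 0 → ω i j = 0)
    (hωlt : ∀ i j, |ω i j| < 1)
    (x : ℝ) (hx : 1 ≤ x)
    (H : Matrix V V ℝ)
    (hH : ∀ i j, H i j =
      (if i = j then 1 + ∑ k, (if A i k = 1 then ω i k ^ 2 / (x ^ 2 - ω i k ^ 2) else 0) else 0)
      - A i j * (x * ω i j / (x ^ 2 - ω i j ^ 2))) :
    (∃ g : {p : V × V // A p.1 p.2 = 1} → ℝ, g ≠ 0 ∧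
      ∀ e : {p : V × V // A p.1 p.2 = 1},
        (∑ e' : {p : V × V // A p.1 p.2 = 1},
          if e.1.2 = e'.1.1 ∧ e.1.1 ≠ e'.1.2 then ω e'.1.1 e'.1.2 * g e' else 0)
        = x * g e)
    ↔ H.det = 0 := by
  have hω0 : ∀ i j, A i j ≠ 1 → ω i j = 0 := fun i j h =>
    hωsupp i j ((hA01 i j).resolve_right h)
  have hD : ∀ i j, x ^ 2 - ω i j ^ 2 ≠ 0 := fun i j => by
    have := (sq_lt_one_iff_abs_lt_one (ω i j)).2 (hωlt i j)
    nlinarith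
  have hx0 : x ≠ 0 := by linarith
  have hmul : ∀ v : V → ℝ, ∀ i, H.mulVec v i =
      v i - ∑ j, ω i j * ((x * v j - ω i j * v i) / (x ^ 2 - ω i j ^ 2)) := fun v i => by
    simp only [Matrix.mulVec, dotProduct, hH, sub_mul, ite_mul, zero_mul,
      Finset.sum_sub_distrib, Finset.sum_ite_eq, Finset.mem_univ, if_true]
    rw [add_mul, one_mul, add_sub_assoc, sub_eq_add_neg (v i), Finset.sum_mul,
      ← Finset.sum_sub_distrib, ← Finset.sum_neg_distrib]
    congr 1
    refine Finset.sum_congr rfl fun j _ => ?_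
    by_cases hA : A i j = 1
    · simp only [hA, if_true]
      ring
    · simp [hA, hω0 i j hA]
  rw [← Matrix.exists_mulVec_eq_zero_iff]
  constructor
  · rintro ⟨g, hg0, hg⟩
    let G : V → V → ℝ := fun i j => if h : A i j = 1 then g ⟨(i, j), h⟩ else 0
    have hGg : ∀ e : {p : V × V // A p.1 p.2 = 1}, g e = G e.1.1 e.1.2 := fun e => by
      simp [G, e.2]
    let S : V → ℝ := fun j => ∑ l, ω j l * G j l
    have hG : ∀ i j, A i j = 1 → S j - ω j i * G j i = x * G i j := fun i j h => by
      have := hg ⟨(i, j), h⟩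
      simp only [hGg] at this
      rwa [sum_nonbacktracking_eq A ω hω0 G i j] at this
    have hGS : ∀ i j, A i j = 1 → G i j = (x * S j - ω i j * S i) / (x ^ 2 - ω i j ^ 2) :=
      fun i j h => by
        rw [eq_div_iff (hD i j)]
        have h1 := hG i j h
        have h2 := hG j i ((hAsymm j i).trans h)
        rw [hωsymm j i] at h1
        linear_combination (-x) * h1 + ω i j * h2
    refine ⟨S, fun hS => hg0 ?_, ?_⟩
    · funext e
      rw [hGg, hGS _ _ e.2, hS]
      simp
    · funext i
      rw [hmul, Pi.zero_apply, sub_eq_zero]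
      refine Finset.sum_congr rfl fun j _ => ?_
      by_cases hA : A i j = 1
      · rw [hGS i j hA]
      · simp [hω0 i j hA]
  · rintro ⟨v, hv0, hv⟩
    let G : V → V → ℝ := fun i j => (x * v j - ω i j * v i) / (x ^ 2 - ω i j ^ 2)
    have hS : ∀ i, ∑ j, ω i j * G i j = v i := fun i => by
      have := congrFun hv i
      rw [hmul, Pi.zero_apply, sub_eq_zero] at this
      exact this.symm
    refine ⟨fun e => G e.1.1 e.1.2, fun hG => hv0 ?_, ?_⟩
    · funext i
      rw [← hS i]
      refine Finset.sum_eq_zero fun j _ => ?_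
      by_cases hA : A i j = 1
      · have hGij : G i j = 0 := congrFun hG ⟨(i, j), hA⟩
        rw [hGij, mul_zero]
      · rw [hω0 i j hA, zero_mul]
    · rintro ⟨⟨i, j⟩, h⟩
      rw [sum_nonbacktracking_eq A ω hω0 G i j, hS]
      simp only [G, hωsymm j i]
      have := hD i j
      field_simp
      ring
end

section
/- Define F : ℝ^V → ℝ by F(m) = (1/2)·Σ_{i,j∈V} A_{ij} · Σ_{s,s'∈{−1,1}} f((1 + m_i·s + m_j·s' + χ_{ij}·s·s')/4) − Σ_{i∈V} (d_i − 1) · Σ_{s∈{−1,1}} f((1 + m_i·s)/2), where f(x) = x·log x. Then F is twice differentiable at m = 0 and its second partial derivatives at 0 are: for i ≠ j, ∂²F/∂m_i∂m_j(0) = −A_{ij}·χ_{ij}/(1 − χ_{ij}²), and for i = j, ∂²F/∂m_i²(0) = Σ_{k∈V} A_{ik}/(1 − χ_{ik}²) − (d_i − 1). -/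
/-- `F` is `C²` at `x`, and its second derivative there is the bilinear form `B`. -/
def HasHessianAt {E : Type*} [NormedAddCommGroup E] [NormedSpace ℝ E]
    (F : E → ℝ) (B : E →L[ℝ] E →L[ℝ] ℝ) (x : E) : Prop :=
  ContDiffAt ℝ 2 F x ∧ HasFDerivAt (fderiv ℝ F) B x

namespace HasHessianAt

variable {E : Type*} [NormedAddCommGroup E] [NormedSpace ℝ E] {F G : E → ℝ}
  {B C : E →L[ℝ] E →L[ℝ] ℝ} {x : E}

theorem eventually_differentiableAt (hF : ContDiffAt ℝ 2 F x) :
    ∀ᶠ y in nhds x, DifferentiableAt ℝ F y :=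
  (hF.eventually (by simp)).mono fun _ hy => hy.differentiableAt (by simp)

theorem add (hF : HasHessianAt F B x) (hG : HasHessianAt G C x) :
    HasHessianAt (fun y => F y + G y) (B + C) x := by
  refine ⟨hF.1.add hG.1, (hF.2.add hG.2).congr_of_eventuallyEq ?_⟩
  filter_upwards [eventually_differentiableAt hF.1, eventually_differentiableAt hG.1] with y h h'
  exact fderiv_fun_add h h'

theorem const_mul (hF : HasHessianAt F B x) (c : ℝ) :
    HasHessianAt (fun y => c * F y) (c • B) x := by
  refine ⟨contDiffAt_const.mul hF.1, (hF.2.const_smul c).congr_of_eventuallyEq ?_⟩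
  filter_upwards [eventually_differentiableAt hF.1] with y h
  exact fderiv_const_mul h c

theorem sub (hF : HasHessianAt F B x) (hG : HasHessianAt G C x) :
    HasHessianAt (fun y => F y - G y) (B - C) x := by
  have h := hF.add (hG.const_mul (-1))
  have hBC : B + (-1 : ℝ) • C = B - C := by module
  simpa only [hBC, neg_one_mul, ← sub_eq_add_neg] using h

theorem sum {ι : Type*} {s : Finset ι} {F : ι → E → ℝ} {B : ι → E →L[ℝ] E →L[ℝ] ℝ}
    (h : ∀ k ∈ s, HasHessianAt (F k) (B k) x) :
    HasHessianAt (fun y => ∑ k ∈ s, F k y) (∑ k ∈ s, B k) x := by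
  classical
  induction s using Finset.induction_on with
  | empty =>
    refine ⟨by simpa using contDiffAt_const, ?_⟩
    have : fderiv ℝ (fun y : E => ∑ k ∈ (∅ : Finset ι), F k y) = fun _ => 0 := by
      ext y; simp
    rw [this]
    simpa using hasFDerivAt_const (0 : E →L[ℝ] ℝ) x
  | insert a s ha ih =>
    simp only [Finset.sum_insert ha]
    exact (h a (by simp)).add (ih fun k hk => h k (by simp [hk]))

theorem fderiv_fderiv_apply (hF : HasHessianAt F B x) (u v : E) :
    fderiv ℝ (fun y => fderiv ℝ F y v) x u = B u v := by
  rw [(hF.2.clm_apply (hasFDerivAt_const v x)).fderiv]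
  simp

/-- The Hessian of `y ↦ (c + ℓ y) log (c + ℓ y)` at the origin is `c⁻¹ ℓ ⊗ ℓ`. -/
theorem affine_mul_log {c : ℝ} (hc : 0 < c) (l : E →L[ℝ] ℝ) :
    HasHessianAt (fun y => (c + l y) * Real.log (c + l y)) ((c⁻¹ • l).smulRight l) 0 := by
  have hne : c + l 0 ≠ 0 := by simpa using hc.ne'
  have hl : ∀ y, HasFDerivAt (fun y => c + l y) l y := fun y => l.hasFDerivAt.const_add c
  have hcd : ContDiffAt ℝ 2 (fun y => c + l y) 0 := contDiffAt_const.add l.contDiff.contDiffAt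
  refine ⟨hcd.mul (hcd.log hne), ?_⟩
  have hlog : HasFDerivAt (fun y => Real.log (c + l y) + 1) (c⁻¹ • l) 0 := by
    simpa using ((hl 0).log hne).add_const 1
  refine (hlog.smul_const l).congr_of_eventuallyEq ?_
  filter_upwards [(hl 0).continuousAt.eventually_ne hne] with y hy
  rw [((hl y).fun_mul ((hl y).log hy)).fderiv]
  ext v
  simp
  field_simp
  ring

end HasHessianAt


/-- The Bethe free energy `F` (as a function of the magnetizations, with
edge correlations `χ` fixed) is twice differentiable at `m = 0`, and its Hessian at `0` is
the Bethe-Hessian matrix: `∂²F/∂m_i∂m_j(0) = −A_{ij} χ_{ij}/(1−χ_{ij}²)` for `i ≠ j` and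
`∂²F/∂m_i²(0) = Σ_k A_{ik}/(1−χ_{ik}²) − (d_i − 1)`. -/
theorem bethe_free_energy_hessian_at_zero
    {V : Type*} [Fintype V] [DecidableEq V]
    (A : V → V → ℝ)
    (hAsymm : ∀ i j, A i j = A j i) (hAdiag : ∀ i, A i i = 0)
    (hA01 : ∀ i j, A i j = 0 ∨ A i j = 1)
    (χ : V → V → ℝ)
    (hχsymm : ∀ i j, χ i j = χ j i)
    (hχlt : ∀ i j, |χ i j| < 1)
    (hχsupp : ∀ i j, A i j = 0 → χ i j = 0)
    (d : V → ℝ) (hd : ∀ i, d i = ∑ j, A i j)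
    (f : ℝ → ℝ) (hf : ∀ x, f x = x * Real.log x)
    (F : (V → ℝ) → ℝ)
    (hF : ∀ m, F m =
      (1 / 2) * (∑ i, ∑ j, A i j *
        ∑ s ∈ ({-1, 1} : Finset ℝ), ∑ s' ∈ ({-1, 1} : Finset ℝ),
          f ((1 + m i * s + m j * s' + χ i j * s * s') / 4))
      - ∑ i, (d i - 1) * ∑ s ∈ ({-1, 1} : Finset ℝ), f ((1 + m i * s) / 2)) :
    ContDiffAt ℝ 2 F 0 ∧
    ∀ i j, fderiv ℝ (fun m => fderiv ℝ F m (Pi.single j 1)) 0 (Pi.single i 1)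
      = if i = j then (∑ k, A i k / (1 - χ i k ^ 2)) - (d i - 1)
        else -(A i j * χ i j / (1 - χ i j ^ 2)) := by
  have hχ : ∀ i j, -1 < χ i j ∧ χ i j < 1 := fun i j => abs_lt.mp (hχlt i j)
  have hne : (-1 : ℝ) ≠ 1 := by norm_num
  let e : V → (V → ℝ) →L[ℝ] ℝ := fun p => ContinuousLinearMap.proj (R := ℝ) p
  have hpair : ∀ p q, ∀ s ∈ ({-1, 1} : Finset ℝ), ∀ s' ∈ ({-1, 1} : Finset ℝ),
      HasHessianAt (fun m : V → ℝ => f ((1 + m p * s + m q * s' + χ p q * s * s') / 4))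
        ((((1 + χ p q * s * s') / 4)⁻¹ • ((s / 4) • e p + (s' / 4) • e q)).smulRight
          ((s / 4) • e p + (s' / 4) • e q)) 0 := by
    intro p q s hs s' hs'
    have hc : 0 < (1 + χ p q * s * s') / 4 := by
      have := hχ p q
      simp only [Finset.mem_insert, Finset.mem_singleton] at hs hs'
      rcases hs with rfl | rfl <;> rcases hs' with rfl | rfl <;> linarith
    convert HasHessianAt.affine_mul_log hc ((s / 4) • e p + (s' / 4) • e q) using 2 with m
    have : (1 + m p * s + m q * s' + χ p q * s * s') / 4 =
        (1 + χ p q * s * s') / 4 + ((s / 4) • e p + (s' / 4) • e q) m := by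
      simp [e]; ring
    rw [hf, this]
  have hsingle : ∀ p, ∀ s ∈ ({-1, 1} : Finset ℝ),
      HasHessianAt (fun m : V → ℝ => f ((1 + m p * s) / 2))
        (((1 / 2 : ℝ)⁻¹ • (s / 2) • e p).smulRight ((s / 2) • e p)) 0 := by
    intro p s _
    convert HasHessianAt.affine_mul_log one_half_pos ((s / 2) • e p) using 2 with m
    have : (1 + m p * s) / 2 = 1 / 2 + ((s / 2) • e p) m := by
      simp [e]; ring
    rw [hf, this]
  have hess := ((HasHessianAt.sum (s := Finset.univ) fun p _ =>
      HasHessianAt.sum (s := Finset.univ) fun q _ =>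
        (HasHessianAt.sum fun s hs => HasHessianAt.sum (hpair p q s hs)).const_mul
          (A p q)).const_mul (1 / 2)).sub
    (HasHessianAt.sum (s := Finset.univ) fun p _ =>
      (HasHessianAt.sum (hsingle p)).const_mul (d p - 1))
  rw [← funext hF] at hess
  refine ⟨hess.1, fun i j => ?_⟩
  rw [hess.fderiv_fderiv_apply]
  let w : V → V → ℝ := fun p q => A p q / (1 - χ p q ^ 2)
  let z : V → V → ℝ := fun p q => A p q * χ p q / (1 - χ p q ^ 2)
  have hw : ∀ p q, w p q = w q p := fun p q => by simp only [w, hAsymm p q, hχsymm p q]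
  have hz : ∀ p q, z p q = z q p := fun p q => by simp only [z, hAsymm p q, hχsymm p q]
  have hedge : ∀ (p q : V) (u v : V → ℝ),
      A p q * ∑ s ∈ ({-1, 1} : Finset ℝ), ∑ s' ∈ ({-1, 1} : Finset ℝ),
        ((1 + χ p q * s * s') / 4)⁻¹ * (s / 4 * u p + s' / 4 * u q) *
          (s / 4 * v p + s' / 4 * v q)
      = (w p q * (u p * v p) - z p q * (u p * v q)) +
        (w p q * (u q * v q) - z p q * (u q * v p)) := by
    intro p q u v
    have h1 : 1 + χ p q ≠ 0 := by linarith [hχ p q]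
    have h2 : 1 - χ p q ≠ 0 := by linarith [hχ p q]
    have h3 : 1 - χ p q ^ 2 = (1 + χ p q) * (1 - χ p q) := by ring
    have h4 : 1 + -χ p q = 1 - χ p q := by ring
    simp only [w, z, h3, Finset.sum_pair hne, mul_neg, mul_one, neg_neg, h4]
    field_simp
    ring
  have hvertex : ∀ (p : V) (u v : V → ℝ), ∑ s ∈ ({-1, 1} : Finset ℝ),
      (1 / 2 : ℝ)⁻¹ * (s / 2 * u p) * (s / 2 * v p) = u p * v p := by
    intro p u v
    rw [Finset.sum_pair hne]
    ring
  have hswap : ∀ u v : V → ℝ, ∑ p, ∑ q, (w p q * (u q * v q) - z p q * (u q * v p)) =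
      ∑ p, ∑ q, (w p q * (u p * v p) - z p q * (u p * v q)) := by
    intro u v
    rw [Finset.sum_comm]
    refine Finset.sum_congr rfl fun p _ => Finset.sum_congr rfl fun q _ => ?_
    rw [hw q p, hz q p]
  have hquad : ∀ u v : V → ℝ, 1 / 2 * ∑ p, ∑ q, A p q * ∑ s ∈ ({-1, 1} : Finset ℝ),
        ∑ s' ∈ ({-1, 1} : Finset ℝ),
        ((1 + χ p q * s * s') / 4)⁻¹ * (s / 4 * u p + s' / 4 * u q) *
          (s / 4 * v p + s' / 4 * v q) =
      ∑ p, ∑ q, (w p q * (u p * v p) - z p q * (u p * v q)) := by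
    intro u v
    simp only [hedge, Finset.sum_add_distrib]
    rw [hswap]
    ring
  simp only [sub_apply, smul_apply,
    sum_apply, add_apply,
    ContinuousLinearMap.smulRight_apply, ContinuousLinearMap.proj_apply, smul_eq_mul, e,
    hquad, hvertex]
  have hwi : ∑ k, A i k / (1 - χ i k ^ 2) = ∑ k, w i k := rfl
  have hzij : A i j * χ i j / (1 - χ i j ^ 2) = z i j := rfl
  have hzi : z i i = 0 := by simp [z, hAdiag]
  rw [hwi, hzij]
  by_cases hij : i = j
  · subst hij
    simp [Pi.single_apply, Finset.sum_sub_distrib, hzi]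
  · simp [Pi.single_apply, Finset.sum_sub_distrib, hij, Ne.symm hij]
end
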